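/- Tail equivalence for Pareto distributions in the uniform model: Let v have the Pareto distribution with shape a > 1 and location b > 0, and let p ∈ (0,1). Then lim_{j→∞} ( Σ_{ℓ ≥ j} Q_ℓ ) / (p b / j)^a = 1, where Q_ℓ = E[(p v)^ℓ e^{−p v}]/ℓ!. Equivalently, since P(v ≥ j/p) = (p b / j)^a for j ≥ p b, the limiting value of E(W_j^+)/K as the number of colors K tends to infinity is asymptotically equivalent, as j → ∞, to P(v ≥ j/p). -/

import Mathlib

open MeasureTheory Real Filter Topology

lemma hasDerivAt_sum_poisson (n : ℕ) (x : ℝ) :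
    HasDerivAt (fun y : ℝ => ∑ ℓ ∈ Finset.range (n + 1), y ^ ℓ * exp (-y) / ℓ.factorial)
      (-(x ^ n * exp (-x) / n.factorial)) x := by
  have hexp : HasDerivAt (fun y : ℝ => exp (-y)) (-exp (-x)) x := by
    simpa using (hasDerivAt_neg x).exp
  induction n with
  | zero => simpa using hexp
  | succ n ih =>
    have h := ih.add (((hasDerivAt_pow (n + 1) x).mul hexp).div_const ((n + 1).factorial : ℝ))
    refine (h.congr_of_eventuallyEq (Eventually.of_forall fun y => ?_)).congr_deriv ?_
    · simp [Finset.sum_range_succ _ (n + 1)]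
    · have : (n.factorial : ℝ) ≠ 0 := by positivity
      have : (n : ℝ) + 1 ≠ 0 := by positivity
      push_cast [Nat.factorial_succ]
      field_simp
      simp

lemma integral_poisson_density (n : ℕ) (x : ℝ) :
    ∫ t in (0 : ℝ)..x, t ^ n * exp (-t) / n.factorial =
      1 - ∑ ℓ ∈ Finset.range (n + 1), x ^ ℓ * exp (-x) / ℓ.factorial := by
  rw [intervalIntegral.integral_eq_sub_of_hasDerivAt
    (f := fun y => -∑ ℓ ∈ Finset.range (n + 1), y ^ ℓ * exp (-y) / ℓ.factorial)
    (fun y _ => (hasDerivAt_sum_poisson n y).fun_neg.congr_deriv (neg_neg _))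
    (Continuous.intervalIntegrable (by fun_prop) _ _)]
  simp [Finset.sum_range_succ', zero_pow]
  ring

lemma hasSum_poisson (x : ℝ) :
    HasSum (fun ℓ : ℕ => x ^ ℓ * exp (-x) / ℓ.factorial) 1 := by
  have h := (NormedSpace.expSeries_div_hasSum_exp x).mul_right (exp (-x))
  rw [← congrFun Real.exp_eq_exp_ℝ x, ← Real.exp_add, add_neg_cancel, Real.exp_zero] at h
  exact h.congr_fun fun ℓ => by ring

lemma hasSum_poisson_tail (n : ℕ) (x : ℝ) :
    HasSum (fun ℓ : ℕ => if n + 1 ≤ ℓ then x ^ ℓ * exp (-x) / ℓ.factorial else 0)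
      (∫ t in (0 : ℝ)..x, t ^ n * exp (-t) / n.factorial) := by
  rw [integral_poisson_density]
  have h := (hasSum_poisson x).sub (hasSum_sum_of_ne_finset_zero
    (f := fun ℓ : ℕ => if ℓ < n + 1 then x ^ ℓ * exp (-x) / ℓ.factorial else 0)
    (s := Finset.range (n + 1)) (fun ℓ hℓ => if_neg (by simpa using hℓ)))
  rw [Finset.sum_congr rfl fun ℓ hℓ => if_pos (Finset.mem_range.mp hℓ)] at h
  refine h.congr_fun fun ℓ => ?_
  split_ifs <;> first | omega | simp

lemma integrableOn_poisson_density (n : ℕ) :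
    IntegrableOn (fun t : ℝ => t ^ n * exp (-t) / n.factorial) (Set.Ioi 0) := by
  have h := (GammaIntegral_convergent (s := (n : ℝ) + 1) (by positivity)).div_const
    (n.factorial : ℝ)
  refine IntegrableOn.congr_fun h (fun t _ => ?_) measurableSet_Ioi
  simp [mul_comm]

section MixedPoisson

variable {Ω : Type*} [MeasurableSpace Ω] {P : Measure Ω} [IsProbabilityMeasure P] {X : Ω → ℝ}

lemma tsum_mixed_poisson_tail (hX : Measurable X) (hX0 : ∀ᵐ ω ∂P, 0 ≤ X ω) (n : ℕ) :
    (∑' ℓ : ℕ, if n + 1 ≤ ℓ then (∫ ω, X ω ^ ℓ * exp (-(X ω)) ∂P) / ℓ.factorial else 0) =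
      ∫ ω, (∫ t in (0 : ℝ)..X ω, t ^ n * exp (-t) / n.factorial) ∂P := by
  have h := hasSum_integral_of_dominated_convergence (μ := P)
    (F := fun (ℓ : ℕ) ω => if n + 1 ≤ ℓ then X ω ^ ℓ * exp (-(X ω)) / ℓ.factorial else 0)
    (f := fun ω => ∫ t in (0 : ℝ)..X ω, t ^ n * exp (-t) / n.factorial)
    (fun ℓ ω => X ω ^ ℓ * exp (-(X ω)) / ℓ.factorial)
    (fun ℓ => by
      split_ifs
      · exact Measurable.aestronglyMeasurable (by fun_prop)
      · exact aestronglyMeasurable_const)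
    (fun ℓ => by
      filter_upwards [hX0] with ω hω
      have : 0 ≤ X ω ^ ℓ * exp (-(X ω)) / ℓ.factorial := by positivity
      split_ifs
      · rw [norm_of_nonneg this]
      · simpa using this)
    (Eventually.of_forall fun ω => (hasSum_poisson (X ω)).summable)
    (by simp only [(hasSum_poisson _).tsum_eq]; exact integrable_const _)
    (Eventually.of_forall fun ω => hasSum_poisson_tail n (X ω))
  rw [← h.tsum_eq]
  refine tsum_congr fun ℓ => ?_
  split_ifs
  · rw [integral_div]
  · simp

lemma integral_poisson_tail_eq_setIntegral (hX : Measurable X) (hX0 : ∀ᵐ ω ∂P, 0 ≤ X ω) (n : ℕ) :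
    ∫ ω, (∫ t in (0 : ℝ)..X ω, t ^ n * exp (-t) / n.factorial) ∂P =
      ∫ t in Set.Ioi 0, P.real {ω | t < X ω} * (t ^ n * exp (-t) / n.factorial) := by
  have hmeas : Measurable fun t : ℝ => P.real {ω | t < X ω} :=
    Antitone.measurable fun s t hst => measureReal_mono fun ω hω => lt_of_le_of_lt hst hω
  have hg0 : ∀ᵐ t ∂volume.restrict (Set.Ioi (0 : ℝ)), 0 ≤ t ^ n * exp (-t) / n.factorial := by
    filter_upwards [ae_restrict_mem measurableSet_Ioi] with t ht
    have : 0 < t := ht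
    positivity
  have hG : Measurable fun ω => ∫ t in (0 : ℝ)..X ω, t ^ n * exp (-t) / n.factorial := by
    simp only [integral_poisson_density]
    fun_prop
  rw [integral_eq_lintegral_of_nonneg_ae _ hG.aestronglyMeasurable,
    integral_eq_lintegral_of_nonneg_ae,
    lintegral_comp_eq_lintegral_meas_lt_mul P hX0 hX.aemeasurable
      (fun t _ => Continuous.intervalIntegrable (by fun_prop) _ _) hg0]
  · congr 1
    refine lintegral_congr_ae ?_
    filter_upwards [hg0] with t ht
    rw [ENNReal.ofReal_mul measureReal_nonneg, ofReal_measureReal]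
  · filter_upwards [hg0] with t ht
    exact mul_nonneg measureReal_nonneg ht
  · exact (hmeas.mul (by fun_prop)).aestronglyMeasurable
  · filter_upwards [hX0] with ω hω
    refine intervalIntegral.integral_nonneg hω fun t ht => ?_
    have : 0 ≤ t := ht.1
    positivity

variable {a c : ℝ}

lemma setIntegral_pareto_tail_bounds (hc : 0 < c)
    (htail : ∀ x, c ≤ x → P.real {ω | x < X ω} = (c / x) ^ a) (ha : 0 < a) {n : ℕ} (hn : a ≤ n) :
    c ^ a * Gamma (n + 1 - a) / n.factorial - c ^ (n + 1) / n.factorial ≤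
        ∫ t in Set.Ioi 0, P.real {ω | t < X ω} * (t ^ n * exp (-t) / n.factorial) ∧
      ∫ t in Set.Ioi 0, P.real {ω | t < X ω} * (t ^ n * exp (-t) / n.factorial) ≤
        c ^ a * Gamma (n + 1 - a) / n.factorial := by
  have hs : 0 < (n : ℝ) + 1 - a := by linarith
  have hmeas : Measurable fun t : ℝ => P.real {ω | t < X ω} :=
    Antitone.measurable fun s t hst => measureReal_mono fun ω hω => lt_of_le_of_lt hst hω
  have hint : IntegrableOn
      (fun t : ℝ => P.real {ω | t < X ω} * (t ^ n * exp (-t) / n.factorial)) (Set.Ioi 0) := by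
    refine (integrableOn_poisson_density n).bdd_mul (c := 1) hmeas.aestronglyMeasurable ?_
    exact Eventually.of_forall fun t => by
      rw [norm_of_nonneg measureReal_nonneg]; exact measureReal_le_one
  have hintG : IntegrableOn
      (fun t : ℝ => c ^ a / n.factorial * (exp (-t) * t ^ ((n : ℝ) + 1 - a - 1))) (Set.Ioi 0) :=
    (GammaIntegral_convergent hs).const_mul _
  have hG : c ^ a * Gamma (n + 1 - a) / n.factorial =
      ∫ t in Set.Ioi 0, c ^ a / n.factorial * (exp (-t) * t ^ ((n : ℝ) + 1 - a - 1)) := by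
    rw [integral_const_mul, ← Gamma_eq_integral hs]
    ring
  have hpt : ∀ t : ℝ, 0 < t → c ^ a / n.factorial * (exp (-t) * t ^ ((n : ℝ) + 1 - a - 1)) =
      (c / t) ^ a * (t ^ n * exp (-t) / n.factorial) := fun t ht => by
    rw [show (n : ℝ) + 1 - a - 1 = n - a by ring, rpow_sub ht, rpow_natCast,
      div_rpow hc.le ht.le]
    ring
  have hintE : IntegrableOn
      ((Set.Ioc 0 c).indicator fun _ : ℝ => c ^ n / n.factorial) (Set.Ioi 0) := by
    refine Integrable.integrableOn ?_
    rw [integrable_indicator_iff measurableSet_Ioc]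
    exact integrableOn_const (by simp)
  have hE : c ^ (n + 1) / n.factorial =
      ∫ t in Set.Ioi 0, (Set.Ioc 0 c).indicator (fun _ : ℝ => c ^ n / n.factorial) t := by
    rw [setIntegral_indicator measurableSet_Ioc,
      Set.inter_eq_self_of_subset_right Set.Ioc_subset_Ioi_self]
    simp [hc.le]
    ring
  constructor
  · rw [sub_le_iff_le_add, hG, hE, ← integral_add hint hintE]
    refine setIntegral_mono_on hintG (hint.add hintE) measurableSet_Ioi fun t ht => ?_
    have ht : 0 < t := ht
    rcases le_or_gt t c with htc | htc
    · rw [Set.indicator_of_mem (Set.mem_Ioc.mpr ⟨ht, htc⟩)]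
      have h1 : c ^ a / n.factorial * (exp (-t) * t ^ ((n : ℝ) + 1 - a - 1)) ≤
          c ^ n / n.factorial := by
        calc _ ≤ c ^ a / n.factorial * (1 * c ^ ((n : ℝ) + 1 - a - 1)) := by
              gcongr
              · exact exp_le_one_iff.mpr (by linarith)
              · linarith
          _ = c ^ n / n.factorial := by
              rw [one_mul, show (n : ℝ) + 1 - a - 1 = n - a by ring, rpow_sub hc, rpow_natCast]
              field_simp
      exact h1.trans (le_add_of_nonneg_left (by positivity))
    · rw [Set.indicator_of_notMem (by simp [htc]), add_zero, hpt t ht, htail t htc.le]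
  · rw [hG]
    refine setIntegral_mono_on hint hintG measurableSet_Ioi fun t ht => ?_
    have ht : 0 < t := ht
    rw [hpt t ht]
    gcongr
    rcases le_or_gt c t with htc | htc
    · exact (htail t htc).le
    · exact measureReal_le_one.trans (one_le_rpow ((one_le_div ht).mpr htc.le) ha.le)

end MixedPoisson

lemma Gamma_add_natCast_eq_prod {s : ℝ} (hs : 0 < s) (k : ℕ) :
    Gamma (s + k) = (∏ i ∈ Finset.range k, (s + i)) * Gamma s := by
  induction k with
  | zero => simp
  | succ k ih =>
    rw [Finset.prod_range_succ, Nat.cast_succ, ← add_assoc, Gamma_add_one (by positivity), ih]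
    ring

lemma tendsto_Gamma_add_div_rpow_mul_factorial {s : ℝ} (hs : 0 < s) :
    Tendsto (fun k : ℕ => Gamma (s + (k + 1 : ℕ)) / ((k : ℝ) ^ s * k.factorial)) atTop (𝓝 1) := by
  have hΓ := (Gamma_pos_of_pos hs).ne'
  have h := (tendsto_const_nhds (x := Gamma s)).div (GammaSeq_tendsto_Gamma s) hΓ
  rw [div_self hΓ] at h
  refine h.congr fun k => ?_
  rw [Gamma_add_natCast_eq_prod hs, Pi.div_apply, GammaSeq, div_div_eq_mul_div, mul_comm]

lemma tendsto_Gamma_sub_div_factorial_mul_rpow (a : ℝ) :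
    Tendsto (fun n : ℕ => Gamma (n + 1 - a) / n.factorial * ((n : ℝ) + 1) ^ a) atTop (𝓝 1) := by
  obtain ⟨m, hm⟩ := exists_nat_gt (max a 0)
  have hma : a < m := (le_max_left _ _).trans_lt hm
  have hm0 : (0 : ℝ) < m := (le_max_right _ _).trans_lt hm
  rw [← tendsto_add_atTop_iff_nat m]
  have h1 := (tendsto_Gamma_add_div_rpow_mul_factorial (sub_pos.mpr hma)).div
    (tendsto_Gamma_add_div_rpow_mul_factorial hm0) one_ne_zero
  have h2 : Tendsto (fun k : ℕ => (1 + ((m : ℝ) + 1) / k) ^ a) atTop (𝓝 1) := by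
    have := (tendsto_const_div_atTop_nhds_zero_nat ((m : ℝ) + 1)).const_add 1
    rw [add_zero] at this
    simpa using this.rpow_const (p := a) (Or.inl one_ne_zero)
  have h3 := h1.mul h2
  rw [div_one, one_mul] at h3
  refine h3.congr' ?_
  filter_upwards [eventually_gt_atTop 0] with k hk
  have hk : (0 : ℝ) < k := by exact_mod_cast hk
  have e1 : (m : ℝ) - a + (k + 1 : ℕ) = ((k + m : ℕ) : ℝ) + 1 - a := by push_cast; ring
  have e2 : (m : ℝ) + (k + 1 : ℕ) = ((k + m : ℕ) : ℝ) + 1 := by push_cast; ring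
  have e3 : 1 + ((m : ℝ) + 1) / k = (((k + m : ℕ) : ℝ) + 1) / k := by
    push_cast; field_simp; ring
  rw [Pi.div_apply, e1, e2, e3, Gamma_nat_eq_factorial, rpow_sub hk, div_rpow (by positivity) hk.le]
  have := rpow_pos_of_pos hk a
  have := rpow_pos_of_pos hk m
  field_simp

lemma tendsto_pow_div_factorial_mul_rpow {c : ℝ} (hc : 0 < c) (a : ℝ) :
    Tendsto (fun n : ℕ => c ^ (n + 1) / n.factorial * ((n : ℝ) + 1) ^ a) atTop (𝓝 0) := by
  obtain ⟨m, hm⟩ := exists_nat_ge a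
  have h1 := (FloorSemiring.tendsto_pow_div_factorial_atTop (2 * c)).comp (tendsto_add_atTop_nat 1)
  have h2 := (tendsto_pow_const_div_const_pow_of_one_lt (m + 1) (one_lt_two (α := ℝ))).comp
    (tendsto_add_atTop_nat 1)
  have h3 := h1.mul h2
  rw [mul_zero] at h3
  refine squeeze_zero (fun n => by positivity) (fun n => ?_) h3
  calc _ ≤ c ^ (n + 1) / n.factorial * ((n : ℝ) + 1) ^ (m : ℝ) := by
        gcongr
        linarith [(Nat.cast_nonneg n : (0 : ℝ) ≤ n)]
    _ = _ := by
        have : (n : ℝ) + 1 ≠ 0 := by positivity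
        simp only [Function.comp_apply, Nat.factorial_succ]
        push_cast
        rw [rpow_natCast, mul_pow]
        field_simp
        ring

/-- **Tail equivalence for Pareto distributions in the uniform model.** If `v` is
Pareto with shape `a > 1` and location `b > 0`, and `p ∈ (0,1)`, then
`Σ_{ℓ ≥ j} Q_ℓ ∼ (p b / j)^a = P(v ≥ j/p)` as `j → ∞`, where
`Q_ℓ = E[(p v)^ℓ e^{-p v}]/ℓ!`. -/
theorem pareto_tail_equivalence_uniform_model
    {Ω : Type*} [MeasurableSpace Ω] (P : Measure Ω) [IsProbabilityMeasure P]
    (a b : ℝ) (ha : 1 < a) (hb : 0 < b)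
    (v : Ω → ℝ) (hv : Measurable v)
    (htail : ∀ x : ℝ, b ≤ x → (P {ω | x < v ω}).toReal = (b / x) ^ a)
    (p : ℝ) (hp : p ∈ Set.Ioo (0:ℝ) 1) :
    Tendsto
      (fun j : ℕ =>
        (∑' ℓ : ℕ, if j ≤ ℓ then
            (∫ ω, (p * v ω) ^ ℓ * Real.exp (-(p * v ω)) ∂P) / ℓ.factorial else 0) /
          (p * b / j) ^ a)
      atTop (𝓝 1) := by
  obtain ⟨hp, -⟩ := hp
  have hc : 0 < p * b := mul_pos hp hb
  have hX : Measurable fun ω => p * v ω := hv.const_mul p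
  have hX0 : ∀ᵐ ω ∂P, 0 ≤ p * v ω := by
    have h1 : P {ω | b < v ω} = 1 := by
      have h := htail b le_rfl
      rw [div_self hb.ne', one_rpow] at h
      rwa [← ENNReal.toReal_eq_one_iff]
    have h2 : ∀ᵐ ω ∂P, b < v ω :=
      (mem_ae_iff_prob_eq_one (measurableSet_lt measurable_const hv)).mpr h1
    filter_upwards [h2] with ω hω
    exact mul_nonneg hp.le (hb.trans hω).le
  have hXtail : ∀ x, p * b ≤ x → P.real {ω | x < p * v ω} = (p * b / x) ^ a := by
    intro x hx
    have h := htail (x / p) (by rwa [le_div_iff₀' hp])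
    simp only [div_lt_iff₀' hp] at h
    rw [measureReal_def, h, div_div_eq_mul_div, mul_comm b]
  rw [← tendsto_add_atTop_iff_nat 1]
  have hup := tendsto_Gamma_sub_div_factorial_mul_rpow a
  have hlow := hup.sub ((tendsto_pow_div_factorial_mul_rpow hc a).div_const ((p * b) ^ a))
  rw [zero_div, sub_zero] at hlow
  obtain ⟨N, hN⟩ := exists_nat_ge a
  have hca := rpow_pos_of_pos hc a
  have key : ∀ n : ℕ, (p * b / ((n + 1 : ℕ) : ℝ)) ^ a = (p * b) ^ a / ((n : ℝ) + 1) ^ a :=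
    fun n => by rw [Nat.cast_succ, div_rpow hc.le (by positivity)]
  have hbounds : ∀ n : ℕ, N ≤ n → _ := fun n hn =>
    setIntegral_pareto_tail_bounds hc hXtail (by linarith) (hN.trans (Nat.cast_le.mpr hn))
  refine tendsto_of_tendsto_of_tendsto_of_le_of_le' hlow hup ?_ ?_
  · filter_upwards [eventually_ge_atTop N] with n hn
    have hna : 0 < ((n : ℝ) + 1) ^ a := by positivity
    rw [tsum_mixed_poisson_tail hX hX0, integral_poisson_tail_eq_setIntegral hX hX0, key,
      le_div_iff₀ (by positivity)]
    refine le_trans (le_of_eq ?_) (hbounds n hn).1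
    field_simp
  · filter_upwards [eventually_ge_atTop N] with n hn
    have hna : 0 < ((n : ℝ) + 1) ^ a := by positivity
    rw [tsum_mixed_poisson_tail hX hX0, integral_poisson_tail_eq_setIntegral hX hX0, key,
      div_le_iff₀ (by positivity)]
    refine (hbounds n hn).2.trans (le_of_eq ?_)
    field_simp
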